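/- arXiv:2509.24261 — 9 statements merged into one kernel-verified Lean document; each statement's English description precedes it below -/
import Mathlib

section
/- Let K ≥ 2, r : {1,…,K} → ℝ, and β ≠ 0. For θ ∈ ℝ^K define the softmax policy π_θ(i) = exp(θ_i)/∑_{j=1}^K exp(θ_j) and the risk-sensitive objective J_RS(θ) = (1/β)·log(∑_{j=1}^K π_θ(j)·exp(β r(j))). Then for every index i, the partial derivative satisfies ∂J_RS/∂θ_i (θ) = π_θ(i) · A_θ^β(i), where A_θ^β(i) = (1/β)·(exp(β r(i))/∑_{j=1}^K π_θ(j) exp(β r(j)) − 1) is the risk-sensitive advantage. -/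
/-- Softmax policy: `π_θ(i) = exp(θ i) / ∑ j, exp(θ j)`. -/
noncomputable def softmax {K : ℕ} (θ : Fin K → ℝ) (i : Fin K) : ℝ :=
  Real.exp (θ i) / ∑ j, Real.exp (θ j)

/-- Risk-sensitive advantage `A_θ^β(i) = (1/β)(exp(β r i)/∑_j π_θ(j) exp(β r j) − 1)`. -/
noncomputable def advRS {K : ℕ} (r θ : Fin K → ℝ) (β : ℝ) (i : Fin K) : ℝ :=
  (1 / β) * (Real.exp (β * r i) / (∑ j, softmax θ j * Real.exp (β * r j)) - 1)

/-- Derivative of a weighted sum of exponentials in one coordinate. -/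
theorem hasDerivAt_sum_exp_update {K : ℕ} (c θ : Fin K → ℝ) (i : Fin K) :
    HasDerivAt (fun t : ℝ => ∑ j, Real.exp (Function.update θ i t j) * c j)
      (Real.exp (θ i) * c i) (θ i) := by
  have h : ∀ j ∈ (Finset.univ : Finset (Fin K)),
      HasDerivAt (fun t : ℝ => Real.exp (Function.update θ i t j) * c j)
        (if j = i then Real.exp (θ i) * c i else 0) (θ i) := by
    intro j _
    by_cases hj : j = i
    · subst hj
      simpa using (Real.hasDerivAt_exp (θ j)).mul_const (c j)
    · simpa [hj] using hasDerivAt_const (θ i) (Real.exp (θ j) * c j)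
  simpa using HasDerivAt.fun_sum h

/-- the partial derivative of the risk-sensitive objective
`J_RS(θ) = (1/β) log (∑_j π_θ(j) exp(β r j))` with respect to `θ i` equals
`π_θ(i) · A_θ^β(i)`. -/
theorem risk_sensitive_policy_gradient {K : ℕ} (hK : 2 ≤ K) (r : Fin K → ℝ)
    (β : ℝ) (hβ : β ≠ 0) (θ : Fin K → ℝ) (i : Fin K) :
    HasDerivAt
      (fun t : ℝ =>
        (1 / β) *
          Real.log (∑ j, softmax (Function.update θ i t) j * Real.exp (β * r j)))
      (softmax θ i * advRS r θ β i) (θ i) := by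
  have hne : (Finset.univ : Finset (Fin K)).Nonempty := ⟨i, Finset.mem_univ i⟩
  have hsum : ∀ η : Fin K → ℝ, ∑ j, softmax η j * Real.exp (β * r j)
      = (∑ j, Real.exp (η j) * Real.exp (β * r j)) / ∑ j, Real.exp (η j) := by
    intro η
    rw [Finset.sum_div]
    refine Finset.sum_congr rfl fun j _ => ?_
    unfold softmax
    ring
  have hN := hasDerivAt_sum_exp_update (fun j => Real.exp (β * r j)) θ i
  have hD := hasDerivAt_sum_exp_update (fun _ => 1) θ i
  simp only [mul_one] at hD
  have hNpos : 0 < ∑ j, Real.exp (θ j) * Real.exp (β * r j) :=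
    Finset.sum_pos (fun j _ => by positivity) hne
  have hDpos : 0 < ∑ j, Real.exp (θ j) :=
    Finset.sum_pos (fun j _ => by positivity) hne
  have hQ := hN.fun_div hD (by simpa using hDpos.ne')
  have hL := (hQ.log (by simpa using (div_pos hNpos hDpos).ne')).const_mul (1 / β)
  simp only [hsum, advRS]
  refine hL.congr_deriv ?_
  simp only [Function.update_eq_self, softmax]
  generalize (∑ j, Real.exp (θ j) * Real.exp (β * r j)) = N at *
  generalize (∑ j, Real.exp (θ j)) = D at *
  have h1 := hNpos.ne'
  have h2 := hDpos.ne'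
  field_simp
end

section
/- Suppose there exists an arm i' with max_j r(j) > r(i') > min_j r(j). Then there exist parameters θ ∈ ℝ^K such that for every learning rate α > 0 and every optimal arm i ∈ I*, the standard policy-gradient update strictly decreases its probability: π_{θ̃}(i) < π_θ(i), where θ̃_i = θ_i + α π_θ(i) A_θ(i) for all i; in particular π_{θ̃}(I*) < π_θ(I*). -/
/-- Standard advantage `A_θ(i) = r i − ∑_j π_θ(j) r j`. -/
noncomputable def advStd {K : ℕ} (r θ : Fin K → ℝ) (i : Fin K) : ℝ :=
  r i - ∑ j, softmax θ j * r j

/-- Jensen-type lemma: a logit whose increment is below the mean increment loses probability. -/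
lemma softmax_decrease {K : ℕ} (θ u : Fin K → ℝ) (i : Fin K) (α : ℝ) (hα : 0 < α)
    (h : u i * ∑ j, Real.exp (θ j) < ∑ j, Real.exp (θ j) * u j) :
    softmax (fun j => θ j + α * u j) i < softmax θ i := by
  have hne : (Finset.univ : Finset (Fin K)).Nonempty := ⟨i, Finset.mem_univ i⟩
  have hZ : 0 < ∑ j, Real.exp (θ j) := Finset.sum_pos (fun j _ => Real.exp_pos _) hne
  have hZ' : 0 < ∑ j, Real.exp (θ j + α * u j) := Finset.sum_pos (fun j _ => Real.exp_pos _) hne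
  unfold softmax
  rw [div_lt_div_iff₀ hZ' hZ, Real.exp_add, mul_assoc]
  refine mul_lt_mul_of_pos_left ?_ (Real.exp_pos _)
  have h1 : ∀ j, Real.exp (α * u i) * (Real.exp (θ j) * (1 + α * (u j - u i)))
      ≤ Real.exp (θ j + α * u j) := by
    intro j
    have h2 := Real.add_one_le_exp (α * (u j - u i))
    have h3 : Real.exp (θ j + α * u j)
        = Real.exp (α * u i) * (Real.exp (θ j) * Real.exp (α * (u j - u i))) := by
      rw [← Real.exp_add, ← Real.exp_add]
      congr 1
      ring
    rw [h3]
    gcongr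
    linarith
  refine lt_of_lt_of_le ?_ (Finset.sum_le_sum fun j _ => h1 j)
  rw [← Finset.mul_sum]
  refine mul_lt_mul_of_pos_left ?_ (Real.exp_pos _)
  have h4 : ∑ j, Real.exp (θ j) * (1 + α * (u j - u i))
      = ∑ j, Real.exp (θ j)
        + α * (∑ j, Real.exp (θ j) * u j - u i * ∑ j, Real.exp (θ j)) := by
    rw [Finset.mul_sum, ← Finset.sum_sub_distrib, Finset.mul_sum, ← Finset.sum_add_distrib]
    refine Finset.sum_congr rfl fun j _ => ?_
    ring
  rw [h4]
  have := mul_pos hα (sub_pos.mpr h)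
  linarith

/-- Weights: `2` on `a`, `1` on `m`, `ε` elsewhere. -/
noncomputable def pgWeight {K : ℕ} (a m : Fin K) (ε : ℝ) (j : Fin K) : ℝ :=
  if j = a then 2 else if j = m then 1 else ε

lemma pgWeight_sum {K : ℕ} (a m : Fin K) (ham : a ≠ m) (f : ℝ → Fin K → ℝ)
    (hf : ∀ j, f 0 j = 0) :
    ∑ j, f (pgWeight a m 0 j) j = f 2 a + f 1 m := by
  rw [← Finset.sum_subset (Finset.subset_univ {a, m}), Finset.sum_pair ham]
  · simp [pgWeight, ham.symm]
  · intro j _ hj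
    simp only [Finset.mem_insert, Finset.mem_singleton, not_or] at hj
    simp [pgWeight, hj.1, hj.2, hf]

/-- if there is an arm `i'` with `min_j r j < r i' < max_j r j`, then there
exist parameters `θ` such that for every learning rate `α > 0`, the standard
policy-gradient update `θ̃ = θ + α π_θ A_θ` strictly decreases the probability of every
optimal arm, and in particular the total probability of the optimal-arm set `I*`. -/
theorem standard_pg_can_decrease_optimal_prob {K : ℕ} (hK : 2 ≤ K)
    (r : Fin K → ℝ) (hr01 : ∀ j, 0 ≤ r j ∧ r j ≤ 1)
    (rmax rmin : ℝ)
    (hmax : ∀ j, r j ≤ rmax) (hmax' : ∃ j, r j = rmax)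
    (hmin : ∀ j, rmin ≤ r j) (hmin' : ∃ j, r j = rmin)
    (i' : Fin K) (hi'1 : r i' < rmax) (hi'2 : rmin < r i') :
    ∃ θ : Fin K → ℝ, ∀ α > (0 : ℝ),
      (∀ i, r i = rmax →
        softmax (fun j => θ j + α * softmax θ j * advStd r θ j) i < softmax θ i) ∧
      ∑ i ∈ Finset.univ.filter (fun i => r i = rmax),
          softmax (fun j => θ j + α * softmax θ j * advStd r θ j) i
        < ∑ i ∈ Finset.univ.filter (fun i => r i = rmax), softmax θ i := by
  obtain ⟨m, hm⟩ := hmin'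
  have ham : i' ≠ m := by
    rintro rfl
    linarith
  let w := pgWeight i' m
  let G : Fin K → ℝ → ℝ := fun i ε =>
    ∑ j, w ε j ^ 2 * ((∑ k, w ε k) * r j - ∑ k, w ε k * r k)
      - (∑ k, w ε k) * (w ε i * ((∑ k, w ε k) * r i - ∑ k, w ε k * r k))
  have hwc : ∀ j, Continuous fun ε => w ε j := by
    intro j
    simp only [w, pgWeight]
    split_ifs <;> fun_prop
  have hGc : ∀ i, Continuous (G i) := by
    intro i
    simp only [G]
    fun_prop
  have hG0 : ∀ i, r i = rmax → 0 < G i 0 := by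
    intro i hi
    have hi1 : i ≠ i' := by
      rintro rfl
      linarith
    have hi2 : i ≠ m := by
      rintro rfl
      linarith
    have hwi : w 0 i = 0 := by simp [w, pgWeight, hi1, hi2]
    have e1 : ∑ k, w 0 k = 2 + 1 := pgWeight_sum i' m ham (fun x _ => x) (by simp)
    have e2 : ∑ k, w 0 k * r k = 2 * r i' + 1 * r m :=
      pgWeight_sum i' m ham (fun x k => x * r k) (by simp)
    simp only [G, hwi, e1, e2]
    have e3 := pgWeight_sum i' m ham
      (fun x j => x ^ 2 * ((2 + 1) * r j - (2 * r i' + 1 * r m))) (by simp)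
    simp only [w]
    rw [e3]
    linarith
  have hev : ∀ᶠ ε in nhdsWithin (0 : ℝ) (Set.Ioi 0), ∀ i, r i = rmax → 0 < G i ε := by
    rw [Filter.eventually_all]
    intro i
    by_cases hi : r i = rmax
    · have := ((hGc i).tendsto 0).eventually (lt_mem_nhds (hG0 i hi))
      filter_upwards [nhdsWithin_le_nhds this] with ε hε _ using hε
    · exact Filter.Eventually.of_forall fun ε h => absurd h hi
  obtain ⟨ε, hGε, hε⟩ := (hev.and self_mem_nhdsWithin).exists
  have hε0 : 0 < ε := hε
  have hwpos : ∀ j, 0 < w ε j := by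
    intro j
    simp only [w, pgWeight]
    split_ifs <;> first | exact hε0 | norm_num
  have hexp : ∀ j, Real.exp (Real.log (w ε j)) = w ε j := fun j => Real.exp_log (hwpos j)
  refine ⟨fun j => Real.log (w ε j), fun α hα => ?_⟩
  have key : ∀ i, r i = rmax →
      softmax (fun j => Real.log (w ε j) + α * softmax (fun j => Real.log (w ε j)) j
        * advStd r (fun j => Real.log (w ε j)) j) i < softmax (fun j => Real.log (w ε j)) i := by
    intro i hi
    simp only [mul_assoc]
    refine softmax_decrease (fun j => Real.log (w ε j)) (fun j =>
      softmax (fun j => Real.log (w ε j)) j * advStd r (fun j => Real.log (w ε j)) j) i α hα ?_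
    have hZ : 0 < ∑ k, w ε k := Finset.sum_pos (fun j _ => hwpos j) ⟨i, Finset.mem_univ i⟩
    have hu : ∀ j, softmax (fun j => Real.log (w ε j)) j * advStd r (fun j => Real.log (w ε j)) j
        = w ε j * ((∑ k, w ε k) * r j - ∑ k, w ε k * r k) / (∑ k, w ε k) ^ 2 := by
      intro j
      simp only [advStd, softmax, hexp]
      have : ∑ k, w ε k / (∑ k, w ε k) * r k = (∑ k, w ε k * r k) / ∑ k, w ε k := by
        rw [Finset.sum_div]
        exact Finset.sum_congr rfl fun k _ => by ring
      rw [this]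
      field_simp
    simp only [hu, hexp]
    have hg := hGε i hi
    have : ∑ j, w ε j * (w ε j * ((∑ k, w ε k) * r j - ∑ k, w ε k * r k) / (∑ k, w ε k) ^ 2)
        - w ε i * ((∑ k, w ε k) * r i - ∑ k, w ε k * r k) / (∑ k, w ε k) ^ 2 * ∑ k, w ε k
        = G i ε / (∑ k, w ε k) ^ 2 := by
      simp only [G]
      rw [sub_div, Finset.sum_div]
      congr 1
      · exact Finset.sum_congr rfl fun k _ => by ring
      · ring
    have h5 : 0 < G i ε / (∑ k, w ε k) ^ 2 := by positivity
    linarith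
  refine ⟨key, ?_⟩
  obtain ⟨b, hb⟩ := hmax'
  refine Finset.sum_lt_sum_of_nonempty ⟨b, by simp [hb]⟩ fun i hi => key i ?_
  simpa using hi
end

section
/- Assume min_j r(j) < max_j r(j). For every θ ∈ ℝ^K there exists β̄ > 0 such that for all β > β̄ and all learning rates α > 0, the risk-sensitive policy-gradient update strictly increases the total probability of the optimal arms: π_{θ̃^β}(I*) > π_θ(I*), where (θ̃^β)_i = θ_i + α π_θ(i) A_θ^β(i) for all i. -/
/-- assuming `min_j r j < max_j r j`, for every `θ` there exists `β̄ > 0`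
such that for all `β > β̄` and all learning rates `α > 0`, the risk-sensitive
policy-gradient update `θ̃^β = θ + α π_θ A_θ^β` strictly increases the total
probability of the optimal arms `I* = {i : r i = max_j r j}`. -/
theorem risk_sensitive_pg_increases_optimal_prob {K : ℕ} (hK : 2 ≤ K)
    (r : Fin K → ℝ) (hr01 : ∀ j, 0 ≤ r j ∧ r j ≤ 1)
    (rmax : ℝ) (hmax : ∀ j, r j ≤ rmax) (hmax' : ∃ j, r j = rmax)
    (hlt : ∃ j, r j < rmax)
    (θ : Fin K → ℝ) :
    ∃ βbar > (0 : ℝ), ∀ β > βbar, ∀ α > (0 : ℝ),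
      ∑ i ∈ Finset.univ.filter (fun i => r i = rmax), softmax θ i
        < ∑ i ∈ Finset.univ.filter (fun i => r i = rmax),
            softmax (fun j => θ j + α * softmax θ j * advRS r θ β j) i := by
  classical
  obtain ⟨a, ha⟩ := hmax'
  obtain ⟨b, hb⟩ := hlt
  have hpos : ∀ φ : Fin K → ℝ, 0 < ∑ j, Real.exp (φ j) := fun φ =>
    Finset.sum_pos (fun j _ => Real.exp_pos _) ⟨a, Finset.mem_univ a⟩
  have hsp : ∀ j, 0 < softmax θ j := fun j => div_pos (Real.exp_pos _) (hpos θ)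
  have hs1 : ∑ j, softmax θ j = 1 := by
    unfold softmax
    rw [← Finset.sum_div]
    exact div_self (hpos θ).ne'
  have hev : ∀ᶠ β : ℝ in Filter.atTop, ∀ i, r i < rmax →
      Real.exp (-(β * (rmax - r i))) < softmax θ a := by
    rw [Filter.eventually_all]
    intro i
    by_cases hi : r i < rmax
    · have h1 : Filter.Tendsto (fun β : ℝ => Real.exp (-(β * (rmax - r i)))) Filter.atTop
          (nhds 0) :=
        Real.tendsto_exp_neg_atTop_nhds_zero.comp
          (Filter.tendsto_id.atTop_mul_const (sub_pos.2 hi))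
      filter_upwards [h1.eventually_lt_const (hsp a)] with β hβ _
      exact hβ
    · exact Filter.Eventually.of_forall fun β h => absurd h hi
  obtain ⟨B, hB⟩ := Filter.eventually_atTop.1 hev
  refine ⟨max B 1, lt_of_lt_of_le one_pos (le_max_right _ _), fun β hβ α hα => ?_⟩
  have hβB : B ≤ β := (le_max_left _ _).trans hβ.le
  have hβ0 : 0 < β := lt_trans one_pos (lt_of_le_of_lt (le_max_right _ _) hβ)
  set S := ∑ j, softmax θ j * Real.exp (β * r j) with hS
  have hSlt : S < Real.exp (β * rmax) := by
    have : ∑ j, softmax θ j * Real.exp (β * rmax) = Real.exp (β * rmax) := by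
      rw [← Finset.sum_mul, hs1, one_mul]
    rw [← this, hS]
    apply Finset.sum_lt_sum
    · intro j _
      exact mul_le_mul_of_nonneg_left
        (Real.exp_le_exp.2 (mul_le_mul_of_nonneg_left (hmax j) hβ0.le)) (hsp j).le
    · exact ⟨b, Finset.mem_univ b, mul_lt_mul_of_pos_left
        (Real.exp_lt_exp.2 (mul_lt_mul_of_pos_left hb hβ0)) (hsp b)⟩
  have hSge : softmax θ a * Real.exp (β * rmax) ≤ S := by
    rw [hS, ← ha]
    exact Finset.single_le_sum (f := fun j => softmax θ j * Real.exp (β * r j))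
      (fun j _ => (mul_pos (hsp j) (Real.exp_pos _)).le) (Finset.mem_univ a)
  have hS0 : 0 < S := lt_of_lt_of_le (mul_pos (hsp a) (Real.exp_pos _)) hSge
  have hup : ∀ i, r i = rmax → 0 < advRS r θ β i := by
    intro i hi
    unfold advRS
    rw [← hS, hi]
    exact mul_pos (by positivity) (sub_pos.2 ((one_lt_div hS0).2 hSlt))
  have hdown : ∀ i, r i ≠ rmax → advRS r θ β i < 0 := by
    intro i hi
    have h1 := hB β hβB i (lt_of_le_of_ne (hmax i) hi)
    have h2 : Real.exp (β * r i) < S := by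
      refine lt_of_lt_of_le ?_ hSge
      have h3 : Real.exp (β * r i)
          = Real.exp (-(β * (rmax - r i))) * Real.exp (β * rmax) := by
        rw [← Real.exp_add]; congr 1; ring
      rw [h3]
      exact mul_lt_mul_of_pos_right h1 (Real.exp_pos _)
    unfold advRS
    rw [← hS]
    exact mul_neg_of_pos_of_neg (by positivity) (sub_neg.2 ((div_lt_one hS0).2 h2))
  set φ : Fin K → ℝ := fun j => θ j + α * softmax θ j * advRS r θ β j with hφ
  have h1 : ∑ i ∈ Finset.univ.filter (fun i => r i = rmax), Real.exp (θ i)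
      < ∑ i ∈ Finset.univ.filter (fun i => r i = rmax), Real.exp (φ i) := by
    apply Finset.sum_lt_sum_of_nonempty ⟨a, by simp [ha]⟩
    intro i hi
    have := mul_pos (mul_pos hα (hsp i)) (hup i (by simpa using hi))
    exact Real.exp_lt_exp.2 (by simp only [hφ]; linarith)
  have h2 : ∑ i ∈ Finset.univ.filter (fun i => ¬ r i = rmax), Real.exp (φ i)
      < ∑ i ∈ Finset.univ.filter (fun i => ¬ r i = rmax), Real.exp (θ i) := by
    apply Finset.sum_lt_sum_of_nonempty ⟨b, by simp [hb.ne]⟩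
    intro i hi
    have := mul_neg_of_pos_of_neg (mul_pos hα (hsp i)) (hdown i (by simpa using hi))
    exact Real.exp_lt_exp.2 (by simp only [hφ]; linarith)
  have e1 := Finset.sum_filter_add_sum_filter_not Finset.univ (fun i => r i = rmax)
    (fun i => Real.exp (θ i))
  have e2 := Finset.sum_filter_add_sum_filter_not Finset.univ (fun i => r i = rmax)
    (fun i => Real.exp (φ i))
  have p1 : 0 < ∑ i ∈ Finset.univ.filter (fun i => r i = rmax), Real.exp (θ i) :=
    Finset.sum_pos (fun j _ => Real.exp_pos _) ⟨a, by simp [ha]⟩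
  have p2 : 0 < ∑ i ∈ Finset.univ.filter (fun i => ¬ r i = rmax), Real.exp (φ i) :=
    Finset.sum_pos (fun j _ => Real.exp_pos _) ⟨b, by simp [hb.ne]⟩
  have q1 := hpos θ
  have q2 := hpos φ
  have g1 : ∀ ψ : Fin K → ℝ, ∑ i ∈ Finset.univ.filter (fun i => r i = rmax), softmax ψ i
      = (∑ i ∈ Finset.univ.filter (fun i => r i = rmax), Real.exp (ψ i))
        / ∑ j, Real.exp (ψ j) := by
    intro ψ
    unfold softmax
    rw [Finset.sum_div]
  rw [g1 θ, g1 φ, div_lt_div_iff₀ q1 q2, ← e1, ← e2]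
  have m := mul_lt_mul'' h1 h2 p1.le p2.le
  linarith [mul_comm (∑ i ∈ Finset.univ.filter (fun i => r i = rmax), Real.exp (θ i))
    (∑ i ∈ Finset.univ.filter (fun i => r i = rmax), Real.exp (φ i)), mul_add
    (∑ i ∈ Finset.univ.filter (fun i => r i = rmax), Real.exp (θ i))
    (∑ i ∈ Finset.univ.filter (fun i => r i = rmax), Real.exp (φ i))
    (∑ i ∈ Finset.univ.filter (fun i => ¬ r i = rmax), Real.exp (φ i)), mul_add
    (∑ i ∈ Finset.univ.filter (fun i => r i = rmax), Real.exp (φ i))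
    (∑ i ∈ Finset.univ.filter (fun i => r i = rmax), Real.exp (θ i))
    (∑ i ∈ Finset.univ.filter (fun i => ¬ r i = rmax), Real.exp (θ i))]
end

section
/- Assume min_j r(j) < max_j r(j). For every θ ∈ ℝ^K there exists β̄ > 0 such that for every learning rate α > 0 and all β₁ > β₂ > β̄, the one-step improvements of the risk-sensitive update on the optimal-arm mass satisfy 0 < π_{θ̃^{β₁}}(I*) − π_θ(I*) < π_{θ̃^{β₂}}(I*) − π_θ(I*); i.e., the improvement is positive but strictly decreasing in β beyond the threshold β̄. -/
/-- One-step risk-sensitive policy-gradient update `θ̃^β = θ + α π_θ A_θ^β`. -/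
noncomputable def rsUpdate {K : ℕ} (r θ : Fin K → ℝ) (α β : ℝ) : Fin K → ℝ :=
  fun j => θ j + α * softmax θ j * advRS r θ β j


open Filter Topology in
lemma aux_tendsto (d : ℝ) (hd : 0 ≤ d) :
    Tendsto (fun β : ℝ => β * (d * Real.exp (-(β * d)))) atTop (𝓝 0) := by
  rcases hd.eq_or_lt with h | h
  · subst h; simp
  · have h1 := (Real.tendsto_pow_mul_exp_neg_atTop_nhds_zero 1).comp
      (tendsto_id.atTop_mul_const h)
    refine h1.congr fun β => ?_
    simp only [Function.comp, id, pow_one]; ring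

open Filter Topology in
lemma aux_tendsto_exp (d : ℝ) (hd : 0 < d) :
    Tendsto (fun β : ℝ => Real.exp (-(β * d))) atTop (𝓝 0) :=
  Real.tendsto_exp_neg_atTop_nhds_zero.comp (tendsto_id.atTop_mul_const hd)

lemma aux_exp_diff (d b₁ b₂ : ℝ) :
    Real.exp (-(b₂ * d)) - Real.exp (-(b₁ * d)) ≤ (b₁ - b₂) * (d * Real.exp (-(b₂ * d))) := by
  have h : Real.exp (-(b₁ * d)) = Real.exp (-(b₂ * d)) * Real.exp (-((b₁ - b₂) * d)) := by
    rw [← Real.exp_add]; congr 1; ring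
  have h2 := Real.add_one_le_exp (-((b₁ - b₂) * d))
  have h3 := Real.exp_pos (-(b₂ * d))
  rw [h]; nlinarith

lemma aux_softmax {K : ℕ} (I : Finset (Fin K)) (hI : I.Nonempty) (hI' : Iᶜ.Nonempty)
    (w v : Fin K → ℝ) (h1 : ∀ i ∈ I, w i < v i) (h2 : ∀ i ∈ Iᶜ, v i ≤ w i) :
    ∑ i ∈ I, softmax w i < ∑ i ∈ I, softmax v i := by
  unfold softmax
  rw [← Finset.sum_div, ← Finset.sum_div,
    ← Finset.sum_add_sum_compl I (fun j => Real.exp (w j)),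
    ← Finset.sum_add_sum_compl I (fun j => Real.exp (v j))]
  have a := Finset.sum_lt_sum_of_nonempty hI (fun i hi => Real.exp_lt_exp.2 (h1 i hi))
  have b := Finset.sum_le_sum (fun i hi => Real.exp_le_exp.2 (h2 i hi))
  have c : 0 < ∑ i ∈ I, Real.exp (w i) := Finset.sum_pos (fun i _ => Real.exp_pos _) hI
  have d : 0 < ∑ i ∈ Iᶜ, Real.exp (v i) := Finset.sum_pos (fun i _ => Real.exp_pos _) hI'
  rw [div_lt_div_iff₀ (by linarith) (by linarith)]
  nlinarith [mul_lt_mul_of_pos_right a d, mul_le_mul_of_nonneg_left b c.le]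

lemma aux_adv {K : ℕ} (r θ : Fin K → ℝ) (m β : ℝ) (i : Fin K) :
    advRS r θ β i = (Real.exp (-(β * (m - r i))) /
      (∑ j, softmax θ j * Real.exp (-(β * (m - r j)))) - 1) / β := by
  unfold advRS
  have h : ∀ j, Real.exp (-(β * (m - r j))) = Real.exp (β * r j) * Real.exp (-(β * m)) := by
    intro j; rw [← Real.exp_add]; congr 1; ring
  simp_rw [h, ← mul_assoc, ← Finset.sum_mul]
  rw [mul_div_mul_right _ _ (Real.exp_pos _).ne']
  ring

open Filter Topology in
/-- assuming `min_j r j < max_j r j`, for every `θ` there exists `β̄ > 0`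
such that for every learning rate `α > 0` and all `β₁ > β₂ > β̄`, the one-step
improvement of the risk-sensitive update on the optimal-arm probability mass is
positive but strictly decreasing in `β`:
`0 < π_{θ̃^{β₁}}(I*) − π_θ(I*) < π_{θ̃^{β₂}}(I*) − π_θ(I*)`. -/
theorem higher_beta_lower_improvement {K : ℕ} (hK : 2 ≤ K)
    (r : Fin K → ℝ) (hr01 : ∀ j, 0 ≤ r j ∧ r j ≤ 1)
    (rmax : ℝ) (hmax : ∀ j, r j ≤ rmax) (hmax' : ∃ j, r j = rmax)
    (hlt : ∃ j, r j < rmax)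
    (θ : Fin K → ℝ) :
    ∃ βbar > (0 : ℝ), ∀ α > (0 : ℝ), ∀ β₁ β₂ : ℝ, βbar < β₂ → β₂ < β₁ →
      0 < (∑ i ∈ Finset.univ.filter (fun i => r i = rmax),
              softmax (rsUpdate r θ α β₁) i)
          - ∑ i ∈ Finset.univ.filter (fun i => r i = rmax), softmax θ i ∧
      (∑ i ∈ Finset.univ.filter (fun i => r i = rmax),
              softmax (rsUpdate r θ α β₁) i)
          - (∑ i ∈ Finset.univ.filter (fun i => r i = rmax), softmax θ i)
        < (∑ i ∈ Finset.univ.filter (fun i => r i = rmax),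
              softmax (rsUpdate r θ α β₂) i)
          - ∑ i ∈ Finset.univ.filter (fun i => r i = rmax), softmax θ i := by
  classical
  set I := Finset.univ.filter (fun i => r i = rmax) with hIdef
  have hI : I.Nonempty := by
    obtain ⟨j, hj⟩ := hmax'; exact ⟨j, by simp [hIdef, hj]⟩
  have hI' : Iᶜ.Nonempty := by
    obtain ⟨j, hj⟩ := hlt; exact ⟨j, by simp [hIdef, hj.ne]⟩
  have hE : 0 < ∑ j, Real.exp (θ j) :=
    Finset.sum_pos (fun i _ => Real.exp_pos _) (hI.mono (Finset.subset_univ _))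
  have hp : ∀ i, 0 < softmax θ i := fun i => div_pos (Real.exp_pos _) hE
  have hsum : ∑ i, softmax θ i = 1 := by
    unfold softmax; rw [← Finset.sum_div, div_self hE.ne']
  set p := softmax θ with hpdef
  set D : Fin K → ℝ := fun j => rmax - r j with hD
  have hD0 : ∀ j, 0 ≤ D j := fun j => sub_nonneg.2 (hmax j)
  have hDI : ∀ j ∈ I, D j = 0 := by
    intro j hj; simp [hIdef] at hj; simp [hD, hj]
  have hDI' : ∀ j ∈ Iᶜ, 0 < D j := by
    intro j hj; exact sub_pos.2 (lt_of_le_of_ne (hmax j) (by simpa [hIdef] using hj))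
  set S : ℝ → ℝ := fun β => ∑ j, p j * Real.exp (-(β * D j)) with hS
  set P := ∑ j ∈ I, p j with hP
  have hPpos : 0 < P := Finset.sum_pos (fun i _ => hp i) hI
  have hP1 : P < 1 := by
    rw [← hsum, ← Finset.sum_add_sum_compl I p]
    have := Finset.sum_pos (fun i (_ : i ∈ Iᶜ) => hp i) hI'
    linarith
  have hSeq : ∀ β, S β = P + ∑ j ∈ Iᶜ, p j * Real.exp (-(β * D j)) := by
    intro β
    simp only [hS]
    rw [← Finset.sum_add_sum_compl I]
    congr 1
    exact Finset.sum_congr rfl (fun j hj => by simp [hDI j hj])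
  have hSP : ∀ β, P ≤ S β := by
    intro β; rw [hSeq]
    have : 0 ≤ ∑ j ∈ Iᶜ, p j * Real.exp (-(β * D j)) :=
      Finset.sum_nonneg (fun j _ => mul_nonneg (hp j).le (Real.exp_pos _).le)
    linarith
  have hSpos : ∀ β, 0 < S β := fun β => hPpos.trans_le (hSP β)
  have hSlim : Tendsto S atTop (𝓝 P) := by
    have : Tendsto (fun β => P + ∑ j ∈ Iᶜ, p j * Real.exp (-(β * D j))) atTop
        (𝓝 (P + ∑ j ∈ Iᶜ, p j * 0)) :=
      tendsto_const_nhds.add (tendsto_finsetSum _ fun j hj =>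
        (aux_tendsto_exp (D j) (hDI' j hj)).const_mul _)
    simp only [mul_zero, Finset.sum_const_zero, add_zero] at this
    exact this.congr fun β => (hSeq β).symm
  set T : ℝ → ℝ := fun β => ∑ j, p j * (D j * Real.exp (-(β * D j))) with hT
  have hT0 : ∀ β, 0 ≤ T β := fun β => Finset.sum_nonneg fun j _ =>
    mul_nonneg (hp j).le (mul_nonneg (hD0 j) (Real.exp_pos _).le)
  have hTlim : Tendsto (fun β => β * T β) atTop (𝓝 0) := by
    have : Tendsto (fun β => ∑ j, p j * (β * (D j * Real.exp (-(β * D j))))) atTop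
        (𝓝 (∑ j, p j * 0)) :=
      tendsto_finsetSum _ fun j _ => (aux_tendsto (D j) (hD0 j)).const_mul _
    simp only [mul_zero, Finset.sum_const_zero] at this
    refine this.congr fun β => ?_
    simp only [hT]
    rw [Finset.mul_sum]
    exact Finset.sum_congr rfl fun j _ => by ring
  have C2 : ∀ᶠ β in atTop, β * T β / (P * P) < 1 / S β - 1 := by
    refine Tendsto.eventually_lt (hTlim.div_const (P * P))
      ((tendsto_const_nhds.div hSlim hPpos.ne').sub tendsto_const_nhds) ?_
    rw [zero_div, sub_pos, lt_div_iff₀ hPpos]; linarith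
  have C3 : ∀ᶠ β in atTop, ∀ j ∈ Iᶜ,
      β * (D j * Real.exp (-(β * D j))) / S β < 1 - Real.exp (-(β * D j)) / S β := by
    rw [Filter.eventually_all_finset]
    intro j hj
    refine Tendsto.eventually_lt ((aux_tendsto (D j) (hD0 j)).div hSlim hPpos.ne')
      (tendsto_const_nhds.sub ((aux_tendsto_exp (D j) (hDI' j hj)).div hSlim hPpos.ne')) ?_
    simp
  obtain ⟨B, hB⟩ := Filter.eventually_atTop.1 (C2.and C3)
  refine ⟨max B 1, by positivity, ?_⟩
  intro α hα β₁ β₂ h2 h12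
  have hb2 : 0 < β₂ := lt_trans one_pos ((le_max_right B 1).trans_lt h2)
  have hb1 : 0 < β₁ := hb2.trans h12
  have hB2 : B ≤ β₂ := (le_max_left B 1).trans h2.le
  obtain ⟨c2, c3⟩ := hB β₂ hB2
  obtain ⟨c2', c3'⟩ := hB β₁ (hB2.trans h12.le)
  have hadv : ∀ β i, advRS r θ β i = (Real.exp (-(β * D i)) / S β - 1) / β :=
    fun β i => aux_adv r θ rmax β i
  have hSle : S β₁ ≤ S β₂ := Finset.sum_le_sum fun j _ =>
    mul_le_mul_of_nonneg_left (Real.exp_le_exp.2 (by nlinarith [hD0 j])) (hp j).le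
  have hSdiff : S β₂ - S β₁ ≤ (β₁ - β₂) * T β₂ := by
    simp only [hS, hT]
    rw [← Finset.sum_sub_distrib, Finset.mul_sum]
    refine Finset.sum_le_sum fun j _ => ?_
    have := mul_le_mul_of_nonneg_left (aux_exp_diff (D j) β₁ β₂) (hp j).le
    linarith
  have hupd : ∀ β i, rsUpdate r θ α β i = θ i + α * p i * advRS r θ β i := fun _ _ => rfl
  have hαp : ∀ i, 0 < α * p i := fun i => mul_pos hα (hp i)
  constructor
  · rw [sub_pos]
    apply aux_softmax I hI hI'
    · intro i hi
      rw [hupd, hadv, hDI i hi]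
      have : 0 ≤ β₁ * T β₁ / (P * P) := by have := hT0 β₁; positivity
      simp only [mul_zero, neg_zero, Real.exp_zero]
      have : 0 < (1 / S β₁ - 1) / β₁ := div_pos (by linarith) hb1
      have := mul_pos (hαp i) this
      linarith
    · intro i hi
      rw [hupd, hadv]
      have h := c3' i hi
      have : 0 ≤ β₁ * (D i * Real.exp (-(β₁ * D i))) / S β₁ := by
        have := hD0 i; have := hSpos β₁; positivity
      have : (Real.exp (-(β₁ * D i)) / S β₁ - 1) / β₁ ≤ 0 :=
        div_nonpos_of_nonpos_of_nonneg (by linarith) hb1.le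
      have := mul_nonpos_of_nonneg_of_nonpos (hαp i).le this
      linarith
  · apply sub_lt_sub_right
    apply aux_softmax I hI hI'
    · intro i hi
      rw [hupd, hupd, hadv, hadv, hDI i hi]
      simp only [mul_zero, neg_zero, Real.exp_zero]
      apply add_lt_add_right
      apply mul_lt_mul_of_pos_left _ (hαp i)
      rw [div_lt_div_iff₀ hb1 hb2]
      have e1 : 1 / S β₁ - 1 / S β₂ ≤ (β₁ - β₂) * T β₂ / (P * P) := by
        rw [div_sub_div _ _ (hSpos _).ne' (hSpos _).ne']
        apply div_le_div₀
        · exact mul_nonneg (by linarith) (hT0 _)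
        · linarith
        · positivity
        · exact mul_le_mul (hSP _) (hSP _) hPpos.le (hSpos _).le
      have e2 := mul_le_mul_of_nonneg_left e1 hb2.le
      have e3 := mul_lt_mul_of_pos_left c2 (sub_pos.2 h12)
      have e4 : β₂ * ((β₁ - β₂) * T β₂ / (P * P)) = (β₁ - β₂) * (β₂ * T β₂ / (P * P)) := by ring
      nlinarith
    · intro i hi
      rw [hupd, hupd, hadv, hadv]
      apply add_le_add_right
      apply mul_le_mul_of_nonneg_left _ (hαp i).le
      rw [div_le_div_iff₀ hb2 hb1]
      have e0 : Real.exp (-(β₁ * D i)) / S β₂ ≤ Real.exp (-(β₁ * D i)) / S β₁ :=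
        div_le_div_of_nonneg_left (Real.exp_pos _).le (hSpos _) hSle
      have e1 := div_le_div_of_nonneg_right (aux_exp_diff (D i) β₁ β₂) (hSpos β₂).le
      rw [sub_div] at e1
      have e2 := mul_le_mul_of_nonneg_left (e1.trans' (sub_le_sub_left e0 _)) hb2.le
      have e3 := mul_lt_mul_of_pos_left (c3 i hi) (sub_pos.2 h12)
      have e4 : β₂ * ((β₁ - β₂) * (D i * Real.exp (-(β₂ * D i))) / S β₂)
        = (β₁ - β₂) * (β₂ * (D i * Real.exp (-(β₂ * D i))) / S β₂) := by ring
      nlinarith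
end

section
/- Assume min_j r(j) < max_j r(j), and let Δ = max_j r(j) − max_{j ∉ I*} r(j) > 0 be the gap between the optimal and second-best reward values. Let θ ∈ ℝ^K with softmax policy π_θ. If β > 0 and β ≥ (1/Δ)·log(1/π_θ(I*)), then the risk-sensitive advantage is strictly negative on every suboptimal arm: A_θ^β(i) < 0 for all i ∉ I*. -/
/-- with `Δ = rmax − rsec > 0` the gap between the optimal and
second-best reward values, if `β > 0` and `β ≥ (1/Δ) log(1/π_θ(I*))`, then the
risk-sensitive advantage is strictly negative on every suboptimal arm. -/
theorem advRS_neg_on_suboptimal {K : ℕ} (hK : 2 ≤ K)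
    (r : Fin K → ℝ) (hr01 : ∀ j, 0 ≤ r j ∧ r j ≤ 1)
    (rmax rsec : ℝ)
    (hmax : ∀ j, r j ≤ rmax) (hmax' : ∃ j, r j = rmax)
    (hsec : ∀ j, r j ≠ rmax → r j ≤ rsec) (hsec' : ∃ j, r j ≠ rmax ∧ r j = rsec)
    (hΔ : 0 < rmax - rsec)
    (θ : Fin K → ℝ) (β : ℝ) (hβ : 0 < β)
    (hβ' : (1 / (rmax - rsec)) *
        Real.log (1 / ∑ i ∈ Finset.univ.filter (fun i => r i = rmax), softmax θ i) ≤ β) :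
    ∀ i, r i ≠ rmax → advRS r θ β i < 0 := by
  intro i hi
  have hZ : 0 < ∑ j, Real.exp (θ j) :=
    Finset.sum_pos (fun j _ => Real.exp_pos _) ⟨i, Finset.mem_univ i⟩
  have hs : ∀ j, 0 < softmax θ j := fun j => div_pos (Real.exp_pos _) hZ
  obtain ⟨k, hk⟩ := hmax'
  set p := ∑ i ∈ Finset.univ.filter (fun i => r i = rmax), softmax θ i with hp
  have hp0 : 0 < p := Finset.sum_pos (fun j _ => hs j) ⟨k, by simp [hk]⟩
  have h1 : -Real.log p ≤ β * (rmax - rsec) := by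
    rw [one_div p, Real.log_inv, one_div, inv_mul_le_iff₀ hΔ] at hβ'
    linarith
  have h2 : Real.exp (β * rsec) ≤ p * Real.exp (β * rmax) := by
    calc Real.exp (β * rsec) ≤ Real.exp (Real.log p + β * rmax) :=
          Real.exp_le_exp.mpr (by linarith)
      _ = p * Real.exp (β * rmax) := by rw [Real.exp_add, Real.exp_log hp0]
  have h3 : p * Real.exp (β * rmax) < ∑ j, softmax θ j * Real.exp (β * r j) := by
    have h4 : p * Real.exp (β * rmax) =
        ∑ j ∈ Finset.univ.filter (fun i => r i = rmax), softmax θ j * Real.exp (β * r j) := by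
      rw [hp, Finset.sum_mul]
      refine Finset.sum_congr rfl fun j hj => ?_
      rw [(Finset.mem_filter.mp hj).2]
    rw [h4]
    exact Finset.sum_lt_sum_of_subset (Finset.filter_subset _ _) (Finset.mem_univ i)
      (by simp [hi]) (mul_pos (hs i) (Real.exp_pos _))
      (fun j _ _ => (mul_pos (hs j) (Real.exp_pos _)).le)
  have h5 : Real.exp (β * r i) ≤ Real.exp (β * rsec) :=
    Real.exp_le_exp.mpr (mul_le_mul_of_nonneg_left (hsec i hi) hβ.le)
  have h6 : Real.exp (β * r i) < ∑ j, softmax θ j * Real.exp (β * r j) := by linarith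
  have h7 := (div_lt_one ((Real.exp_pos _).trans h6)).mpr h6
  unfold advRS
  exact mul_neg_of_pos_of_neg (by positivity) (by linarith)
end

section
/- Let θ ∈ ℝ^K, let S ⊆ {1,…,K} be nonempty with complement nonempty, let α > 0, and let c : {1,…,K} → ℝ satisfy c(i) > 0 for all i ∈ S and c(i) < 0 for all i ∉ S. Define θ̃_i = θ_i + α c(i). Then the softmax probability mass of S strictly increases: ∑_{i∈S} π_{θ̃}(i) > ∑_{i∈S} π_θ(i). -/
/-- if the update `θ̃_i = θ_i + α c(i)` adds a strictly positive amount on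
a nonempty set `S` (with nonempty complement) and a strictly negative amount outside
`S`, then the softmax probability mass of `S` strictly increases. -/
theorem softmax_mass_increase {K : ℕ} (hK : 2 ≤ K) (θ : Fin K → ℝ)
    (S : Finset (Fin K)) (hS : S.Nonempty) (hSc : Sᶜ.Nonempty)
    (α : ℝ) (hα : 0 < α) (c : Fin K → ℝ)
    (hpos : ∀ i ∈ S, 0 < c i) (hneg : ∀ i ∉ S, c i < 0) :
    ∑ i ∈ S, softmax θ i < ∑ i ∈ S, softmax (fun j => θ j + α * c j) i := by
  have e1 : ∑ i ∈ S, Real.exp (θ i) < ∑ i ∈ S, Real.exp (θ i + α * c i) := by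
    apply Finset.sum_lt_sum_of_nonempty hS
    intro i hi
    have := mul_pos hα (hpos i hi)
    exact Real.exp_lt_exp.mpr (by linarith)
  have e2 : ∑ i ∈ Sᶜ, Real.exp (θ i + α * c i) < ∑ i ∈ Sᶜ, Real.exp (θ i) := by
    apply Finset.sum_lt_sum_of_nonempty hSc
    intro i hi
    have := mul_neg_of_pos_of_neg hα (hneg i (Finset.mem_compl.mp hi))
    exact Real.exp_lt_exp.mpr (by linarith)
  have p1 : 0 < ∑ i ∈ S, Real.exp (θ i) :=
    Finset.sum_pos (fun i _ => Real.exp_pos _) hS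
  have p2 : 0 < ∑ i ∈ Sᶜ, Real.exp (θ i + α * c i) :=
    Finset.sum_pos (fun i _ => Real.exp_pos _) hSc
  simp only [softmax]
  rw [← Finset.sum_div, ← Finset.sum_div, ← Finset.sum_add_sum_compl S (fun j => Real.exp (θ j)),
    ← Finset.sum_add_sum_compl S (fun j => Real.exp (θ j + α * c j))]
  rw [div_lt_div_iff₀ (by linarith) (by linarith)]
  have h := mul_lt_mul'' e1 e2 p1.le p2.le
  linarith
end

section
/- Assume min_j r(j) < max_j r(j) and let θ ∈ ℝ^K with softmax policy π_θ. For every optimal arm i ∈ I*, there exists β̄ > 0 such that for all β₁ > β₂ > β̄ one has 0 < A_θ^{β₁}(i) < A_θ^{β₂}(i); i.e., beyond the threshold β̄ the risk-sensitive advantage of an optimal arm remains positive but is strictly decreasing in β. -/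
open Filter Topology in
lemma advRS_aux {K : ℕ} (w d : Fin K → ℝ) (hw : ∀ j, 0 < w j) (hs : ∑ j, w j = 1)
    (hd : ∀ j, 0 ≤ d j) (i k : Fin K) (hi : d i = 0) (hk : 0 < d k) :
    ∃ b > (0 : ℝ), ∀ x y : ℝ, b < y → y < x →
      0 < (1 / x) * (1 / (∑ j, w j * Real.exp (-(x * d j))) - 1) ∧
      (1 / x) * (1 / (∑ j, w j * Real.exp (-(x * d j))) - 1) <
      (1 / y) * (1 / (∑ j, w j * Real.exp (-(y * d j))) - 1) := by
  have : Nonempty (Fin K) := ⟨i⟩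
  set D : ℝ → ℝ := fun x => ∑ j, w j * Real.exp (-(x * d j)) with hD
  set E : ℝ → ℝ := fun x => ∑ j, w j * (d j * Real.exp (-(x * d j))) with hE
  have hDpos : ∀ x, 0 < D x := fun x =>
    Finset.sum_pos (fun j _ => mul_pos (hw j) (Real.exp_pos _)) Finset.univ_nonempty
  have hD1 : ∀ x, 0 < x → D x < 1 := by
    intro x hx
    rw [← hs]
    apply Finset.sum_lt_sum
    · intro j _
      have : Real.exp (-(x * d j)) ≤ 1 := by
        rw [Real.exp_le_one_iff]
        have := mul_nonneg hx.le (hd j)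
        linarith
      nlinarith [hw j]
    · refine ⟨k, Finset.mem_univ _, ?_⟩
      have : Real.exp (-(x * d k)) < 1 := by
        rw [Real.exp_lt_one_iff]
        have := mul_pos hx hk
        linarith
      nlinarith [hw k]
  have hder : ∀ x, HasDerivAt D (-E x) x := by
    intro x
    have : HasDerivAt D (∑ j, w j * (Real.exp (-(x * d j)) * (-(1 * d j)))) x := by
      apply HasDerivAt.fun_sum
      intro j _
      exact ((((hasDerivAt_id x).mul_const (d j)).neg).exp).const_mul (w j)
    convert this using 1
    rw [hE, ← Finset.sum_neg_distrib]
    exact Finset.sum_congr rfl (fun j _ => by ring)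
  have hmul : ∀ j, 0 < d j → Tendsto (fun x : ℝ => x * d j) atTop atTop := fun j hj =>
    tendsto_id.atTop_mul_const hj
  set p := ∑ j, w j * (if d j = 0 then (1 : ℝ) else 0) with hp
  have hDlim : Tendsto D atTop (𝓝 p) := by
    apply tendsto_finset_sum
    intro j _
    apply Tendsto.const_mul
    split_ifs with h
    · simp [h]
    · exact Real.tendsto_exp_neg_atTop_nhds_zero.comp (hmul j (lt_of_le_of_ne (hd j) (Ne.symm h)))
  have hElim : Tendsto (fun x => x * E x) atTop (𝓝 0) := by
    have h1 : Tendsto (fun x => ∑ j, w j * ((x * d j) ^ 1 * Real.exp (-(x * d j)))) atTop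
        (𝓝 (∑ j, w j * 0)) := by
      apply tendsto_finset_sum
      intro j _
      apply Tendsto.const_mul
      rcases (hd j).eq_or_lt with h | h
      · simp [← h]
      · exact (Real.tendsto_pow_mul_exp_neg_atTop_nhds_zero 1).comp (hmul j h)
    simp only [mul_zero, Finset.sum_const_zero] at h1
    refine h1.congr (fun x => ?_)
    rw [hE, Finset.mul_sum]
    exact Finset.sum_congr rfl (fun j _ => by ring)
  have hp0 : 0 < p := by
    apply Finset.sum_pos'
    · intro j _
      have := hw j
      split_ifs <;> simp [this.le]
    · exact ⟨i, Finset.mem_univ _, by simp [hi, hw i]⟩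
  have hp1 : p < 1 := by
    rw [← hs]
    apply Finset.sum_lt_sum
    · intro j _
      have := hw j
      split_ifs <;> simp [this.le]
    · exact ⟨k, Finset.mem_univ _, by simp [hk.ne', hw k]⟩
  have hev : ∀ᶠ x in atTop, x * E x < D x * (1 - D x) := by
    apply hElim.eventually_lt (hDlim.mul (tendsto_const_nhds.sub hDlim))
    exact mul_pos hp0 (by linarith)
  obtain ⟨b0, hb0⟩ := eventually_atTop.1 hev
  have hf : ∀ x, 0 < x → HasDerivAt (fun x => (1 / x) * (1 / D x - 1))
      ((-1 / x ^ 2) * (1 / D x - 1) + (1 / x) * (E x / D x ^ 2)) x := by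
    intro x hx
    have h1 : HasDerivAt (fun x : ℝ => 1 / x) (-1 / x ^ 2) x := by
      have := (hasDerivAt_id x).fun_inv hx.ne'
      simpa using this
    have h2 : HasDerivAt (fun x : ℝ => 1 / D x - 1) (E x / D x ^ 2) x := by
      have := ((hder x).fun_inv (hDpos x).ne').sub_const 1
      simpa using this
    exact h1.mul h2
  refine ⟨max b0 1, by positivity, fun x y hy hxy => ?_⟩
  have hb : 1 ≤ max b0 1 := le_max_right _ _
  have hx0 : 0 < x := by linarith
  refine ⟨?_, ?_⟩
  · have : 1 < 1 / D x := by
      rw [lt_div_iff₀ (hDpos x)]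
      linarith [hD1 x hx0]
    exact mul_pos (by positivity) (by linarith)
  · have hanti : StrictAntiOn (fun x => (1 / x) * (1 / D x - 1)) (Set.Ioi (max b0 1)) := by
      apply strictAntiOn_of_deriv_neg (convex_Ioi _)
      · intro z hz
        have hz : max b0 1 < z := hz
        exact (hf z (by linarith)).continuousAt.continuousWithinAt
      · intro z hz
        rw [interior_Ioi] at hz
        have hz : max b0 1 < z := hz
        have hz0 : 0 < z := by linarith
        rw [(hf z hz0).deriv]
        have hlt := hb0 z (by linarith [le_max_left b0 1])
        have hDz := hDpos z
        have : (-1 / z ^ 2) * (1 / D z - 1) + (1 / z) * (E z / D z ^ 2)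
            = (z * E z - D z * (1 - D z)) / (z ^ 2 * D z ^ 2) := by
          field_simp
          ring
        rw [this]
        exact div_neg_of_neg_of_pos (by linarith) (by positivity)
    exact hanti (Set.mem_Ioi.2 hy) (Set.mem_Ioi.2 (hy.trans hxy)) hxy

/-- assuming `min_j r j < max_j r j`, for every optimal arm `i ∈ I*`
there is a threshold `β̄ > 0` such that for all `β₁ > β₂ > β̄`, the risk-sensitive
advantage of `i` is positive but strictly decreasing in `β`:
`0 < A_θ^{β₁}(i) < A_θ^{β₂}(i)`. -/
theorem advRS_optimal_decreasing_in_beta {K : ℕ} (hK : 2 ≤ K)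
    (r : Fin K → ℝ) (hr01 : ∀ j, 0 ≤ r j ∧ r j ≤ 1)
    (rmax : ℝ) (hmax : ∀ j, r j ≤ rmax) (hmax' : ∃ j, r j = rmax)
    (hlt : ∃ j, r j < rmax)
    (θ : Fin K → ℝ) (i : Fin K) (hi : r i = rmax) :
    ∃ βbar > (0 : ℝ), ∀ β₁ β₂ : ℝ, βbar < β₂ → β₂ < β₁ →
      0 < advRS r θ β₁ i ∧ advRS r θ β₁ i < advRS r θ β₂ i := by
  obtain ⟨k, hk⟩ := hlt
  have : Nonempty (Fin K) := ⟨i⟩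
  have hS : 0 < ∑ j, Real.exp (θ j) :=
    Finset.sum_pos (fun j _ => Real.exp_pos _) Finset.univ_nonempty
  have key := advRS_aux (softmax θ) (fun j => rmax - r j)
    (fun j => div_pos (Real.exp_pos _) hS)
    (by
      unfold softmax
      rw [← Finset.sum_div, div_self hS.ne'])
    (fun j => sub_nonneg.2 (hmax j)) i k (by simp [hi]) (sub_pos.2 hk)
  have heq : ∀ β, advRS r θ β i =
      (1 / β) * (1 / (∑ j, softmax θ j * Real.exp (-(β * (rmax - r j)))) - 1) := by
    intro β
    have h : ∑ j, softmax θ j * Real.exp (β * r j) =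
        Real.exp (β * r i) * ∑ j, softmax θ j * Real.exp (-(β * (rmax - r j))) := by
      rw [Finset.mul_sum]
      refine Finset.sum_congr rfl (fun j _ => ?_)
      rw [mul_left_comm, ← Real.exp_add, hi]
      congr 2
      ring
    unfold advRS
    rw [h, div_mul_eq_div_div, div_self (Real.exp_pos _).ne']
  simpa only [heq] using key
end

section
/- Assume min_j r(j) < max_j r(j) and let θ ∈ ℝ^K with softmax policy π_θ. For every suboptimal arm i ∉ I*, there exists β̄ > 0 such that for all β₁ > β₂ > β̄ one has A_θ^{β₂}(i) < A_θ^{β₁}(i) < 0; i.e., beyond the threshold β̄ the risk-sensitive advantage of a suboptimal arm remains negative but is strictly increasing in β. -/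
/-- assuming `min_j r j < max_j r j`, for every suboptimal arm `i ∉ I*`
there is a threshold `β̄ > 0` such that for all `β₁ > β₂ > β̄`, the risk-sensitive
advantage of `i` is negative but strictly increasing in `β`:
`A_θ^{β₂}(i) < A_θ^{β₁}(i) < 0`. -/
theorem advRS_suboptimal_increasing_in_beta {K : ℕ} (hK : 2 ≤ K)
    (r : Fin K → ℝ) (hr01 : ∀ j, 0 ≤ r j ∧ r j ≤ 1)
    (rmax : ℝ) (hmax : ∀ j, r j ≤ rmax) (hmax' : ∃ j, r j = rmax)
    (hlt : ∃ j, r j < rmax)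
    (θ : Fin K → ℝ) (i : Fin K) (hi : r i ≠ rmax) :
    ∃ βbar > (0 : ℝ), ∀ β₁ β₂ : ℝ, βbar < β₂ → β₂ < β₁ →
      advRS r θ β₂ i < advRS r θ β₁ i ∧ advRS r θ β₁ i < 0 := by
  obtain ⟨k, hk⟩ := hmax'
  have hZ : 0 < ∑ j, Real.exp (θ j) :=
    Finset.sum_pos (fun j _ => Real.exp_pos _) ⟨i, Finset.mem_univ i⟩
  have hp : ∀ j, 0 < softmax θ j := fun j => div_pos (Real.exp_pos _) hZ
  have hd : 0 < rmax - r i := sub_pos.mpr (lt_of_le_of_ne (hmax i) hi)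
  generalize hdd : rmax - r i = d at hd
  have hpk := hp k
  have hpd : 0 < softmax θ k * d ^ 2 := by positivity
  have hS : ∀ β : ℝ, 0 < ∑ j, softmax θ j * Real.exp (β * r j) := fun β =>
    Finset.sum_pos (fun j _ => mul_pos (hp j) (Real.exp_pos _)) ⟨i, Finset.mem_univ i⟩
  -- the key bound
  have key : ∀ β : ℝ, max 1 (4 / (softmax θ k * d ^ 2)) < β →
      Real.exp (β * r i) / (∑ j, softmax θ j * Real.exp (β * r j)) * (1 + β) < 1 := by
    intro β hβ
    have h1 : 1 < β := lt_of_le_of_lt (le_max_left _ _) hβ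
    have h2 : 4 / (softmax θ k * d ^ 2) < β := lt_of_le_of_lt (le_max_right _ _) hβ
    rw [div_lt_iff₀ hpd] at h2
    have h3 : softmax θ k * Real.exp (β * r k) ≤ ∑ j, softmax θ j * Real.exp (β * r j) :=
      Finset.single_le_sum (f := fun j => softmax θ j * Real.exp (β * r j))
        (fun j _ => (mul_pos (hp j) (Real.exp_pos _)).le) (Finset.mem_univ k)
    have h4 : Real.exp (β * r k) = Real.exp (β * r i) * Real.exp (β * d) := by
      rw [← Real.exp_add, hk, ← hdd]; congr 1; ring
    have h5 : (β * d) ^ 2 / 2 ≤ Real.exp (β * d) := by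
      have := Real.quadratic_le_exp_of_nonneg (x := β * d) (by positivity)
      have h0 : 0 < β * d := by positivity
      linarith
    have h6 : 1 + β < softmax θ k * Real.exp (β * d) := by
      have h7 := mul_le_mul_of_nonneg_left h5 hpk.le
      have h8 := mul_lt_mul_of_pos_right h2 (by linarith : 0 < β)
      nlinarith
    rw [div_mul_eq_mul_div, div_lt_one (hS β)]
    refine lt_of_lt_of_le ?_ h3
    rw [h4]
    have := mul_lt_mul_of_pos_left h6 (Real.exp_pos (β * r i))
    linarith
  refine ⟨max 1 (4 / (softmax θ k * d ^ 2)), lt_of_lt_of_le one_pos (le_max_left _ _), ?_⟩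
  intro b₁ b₂ hb hlt'
  have hb2 : 1 < b₂ := lt_of_le_of_lt (le_max_left _ _) hb
  have k2 := key b₂ hb
  have k1 := key b₁ (hb.trans hlt')
  have hS1 := hS b₁
  have hS2 := hS b₂
  have hSS : ∑ j, softmax θ j * Real.exp (b₁ * r j) ≤
      Real.exp (b₁ - b₂) * ∑ j, softmax θ j * Real.exp (b₂ * r j) := by
    rw [Finset.mul_sum]
    refine Finset.sum_le_sum fun j _ => ?_
    have : Real.exp (b₁ * r j) ≤ Real.exp (b₁ - b₂) * Real.exp (b₂ * r j) := by
      rw [← Real.exp_add, Real.exp_le_exp]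
      nlinarith [(hr01 j).2]
    calc _ ≤ softmax θ j * (Real.exp (b₁ - b₂) * Real.exp (b₂ * r j)) :=
          mul_le_mul_of_nonneg_left this (hp j).le
      _ = _ := by ring
  have hEE : Real.exp (b₂ * r i) ≤ Real.exp (b₁ * r i) := by
    rw [Real.exp_le_exp]
    exact mul_le_mul_of_nonneg_right hlt'.le (hr01 i).1
  unfold advRS
  generalize (∑ j, softmax θ j * Real.exp (b₁ * r j)) = S₁ at *
  generalize (∑ j, softmax θ j * Real.exp (b₂ * r j)) = S₂ at *
  have hE1 := Real.exp_pos (b₁ * r i)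
  have hE2 := Real.exp_pos (b₂ * r i)
  have hf : (1 - (b₁ - b₂)) * (Real.exp (b₂ * r i) / S₂) ≤ Real.exp (b₁ * r i) / S₁ := by
    have a1 : Real.exp (b₂ * r i) / (Real.exp (b₁ - b₂) * S₂) ≤ Real.exp (b₁ * r i) / S₁ :=
      div_le_div₀ hE1.le hEE hS1 hSS
    have a2 : 1 - (b₁ - b₂) ≤ Real.exp (-(b₁ - b₂)) := by
      have := Real.add_one_le_exp (-(b₁ - b₂)); linarith
    have a3 : Real.exp (b₂ * r i) / (Real.exp (b₁ - b₂) * S₂) =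
        Real.exp (-(b₁ - b₂)) * (Real.exp (b₂ * r i) / S₂) := by
      rw [Real.exp_neg]; field_simp
    rw [a3] at a1
    exact (mul_le_mul_of_nonneg_right a2 (div_pos hE2 hS2).le).trans a1
  have hf1 := div_pos hE1 hS1
  have hf2 := div_pos hE2 hS2
  generalize Real.exp (b₁ * r i) / S₁ = f₁ at *
  generalize Real.exp (b₂ * r i) / S₂ = f₂ at *
  have hb1 : 0 < b₁ := by linarith
  have hb2' : 0 < b₂ := by linarith
  constructor
  · rw [one_div_mul_eq_div, one_div_mul_eq_div, div_lt_div_iff₀ hb2' hb1]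
    have c1 := mul_le_mul_of_nonneg_left hf hb2'.le
    have c2 := mul_pos (sub_pos.mpr hlt') (sub_pos.mpr k2)
    nlinarith
  · apply mul_neg_of_pos_of_neg (by positivity)
    nlinarith
end

section
/- Let r : {1,…,K} → [0,1], write r_max = max_j r(j) and r_min = min_j r(j), let i⁻ be an arm with r(i⁻) = r_min, and let i' be an arm with r(i') = max_{j ∉ I*} r(j), and assume r_max > r(i') > r_min. Let θ ∈ ℝ^K with softmax policy π_θ. If π_θ(I*) < ((r(i') − r_min)/(r_max − r(i'))) · π_θ(i⁻), then the standard advantage of i' is strictly positive: A_θ(i') = r(i') − ∑_j π_θ(j) r(j) > 0. -/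
/-- let `i⁻` attain the minimum reward and `i'` the best suboptimal
reward, with `rmax > r i' > rmin`. If
`π_θ(I*) < ((r i' − rmin)/(rmax − r i')) · π_θ(i⁻)`, then the standard advantage of
`i'` is strictly positive. -/
theorem advStd_second_best_positive {K : ℕ} (hK : 2 ≤ K)
    (r : Fin K → ℝ) (hr01 : ∀ j, 0 ≤ r j ∧ r j ≤ 1)
    (rmax rmin : ℝ)
    (hmax : ∀ j, r j ≤ rmax) (hmax' : ∃ j, r j = rmax)
    (hmin : ∀ j, rmin ≤ r j)
    (iminus : Fin K) (himinus : r iminus = rmin)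
    (i' : Fin K) (hi'sec : ∀ j, r j ≠ rmax → r j ≤ r i')
    (h1 : r i' < rmax) (h2 : rmin < r i')
    (θ : Fin K → ℝ)
    (hcond : ∑ i ∈ Finset.univ.filter (fun i => r i = rmax), softmax θ i
      < ((r i' - rmin) / (rmax - r i')) * softmax θ iminus) :
    0 < advStd r θ i' := by
  have hZ : 0 < ∑ j, Real.exp (θ j) :=
    Finset.sum_pos (fun j _ => Real.exp_pos _) ⟨i', Finset.mem_univ _⟩
  have hpos : ∀ j, 0 < softmax θ j := fun j => div_pos (Real.exp_pos _) hZ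
  have hsum : ∑ j, softmax θ j = 1 := by
    unfold softmax
    rw [← Finset.sum_div, div_self hZ.ne']
  have hA : advStd r θ i' = ∑ j, softmax θ j * (r i' - r j) := by
    simp only [mul_sub, Finset.sum_sub_distrib]
    rw [← Finset.sum_mul, hsum, one_mul]
    rfl
  have hd : 0 < rmax - r i' := sub_pos.mpr h1
  have hc : (rmax - r i') * ∑ i ∈ Finset.univ.filter (fun i => r i = rmax), softmax θ i
      < (r i' - rmin) * softmax θ iminus := by
    rw [div_mul_eq_mul_div, lt_div_iff₀ hd] at hcond
    linarith
  have hle : ∑ j, ((if j = iminus then (r i' - rmin) * softmax θ j else 0)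
      - (rmax - r i') * (if r j = rmax then softmax θ j else 0))
      ≤ ∑ j, softmax θ j * (r i' - r j) := by
    apply Finset.sum_le_sum
    intro j _
    have hp := hpos j
    by_cases hj : j = iminus
    · subst hj
      have hne : r j ≠ rmax := by
        intro h
        linarith
      rw [if_pos rfl, if_neg hne, himinus]
      linarith
    · by_cases hm : r j = rmax
      · rw [if_neg hj, if_pos hm, hm]
        linarith
      · simp only [if_neg hj, if_neg hm]
        have := mul_nonneg hp.le (sub_nonneg.mpr (hi'sec j hm))
        linarith
  rw [Finset.sum_sub_distrib, ← Finset.mul_sum,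
    Finset.sum_ite_eq' Finset.univ iminus, if_pos (Finset.mem_univ _), ← Finset.sum_filter] at hle
  rw [hA]
  linarith
end
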